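/- For each n let P_{n,ψ} denote the law on ℝ^n of Y = (Y_1, …, Y_n) with Y_1, …, Y_n i.i.d. N(0, 1 + ψ), let M_n(Y) = n^{-1} Σ_{i=1}^n Y_i², let ℓ_n(ψ) = −(n/2){log(1 + ψ) + M_n(Y)/(1 + ψ)}, and let ψ̂_n = max(M_n(Y) − 1, 0). Suppose ψ_n ∈ [0, ∞) satisfies √n · ψ_n → a for some finite a ∈ [0, ∞). Then the law under P_{n,ψ_n} of the likelihood ratio statistic T_n^L = 2{ℓ_n(ψ̂_n) − ℓ_n(ψ_n)} converges weakly, as n → ∞, to the pushforward of the standard normal distribution N(0,1) under the map w ↦ 2w·max(w, −a·2^{-1/2}) − max(w, −a·2^{-1/2})². -/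

import Mathlib

open MeasureTheory ProbabilityTheory Filter Topology

/-- The law on `ℝ^n` of `n` i.i.d. `N(0, 1 + ψ)` random variables. -/
noncomputable def modelLaw (n : ℕ) (ψ : ℝ) : Measure (Fin n → ℝ) :=
  Measure.pi fun _ => gaussianReal 0 (Real.toNNReal (1 + ψ))

/-- `M_n(y) = n⁻¹ ∑ yᵢ²`. -/
noncomputable def Mstat (n : ℕ) (y : Fin n → ℝ) : ℝ := (∑ i, y i ^ 2) / n

/-- The log-likelihood (up to an additive constant)
`ℓ_n(ψ) = −(n/2){log(1 + ψ) + M_n/(1 + ψ)}`. -/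
noncomputable def loglik (n : ℕ) (ψ : ℝ) (y : Fin n → ℝ) : ℝ :=
  -((n : ℝ) / 2) * (Real.log (1 + ψ) + Mstat n y / (1 + ψ))

/-- The maximum likelihood estimator `ψ̂_n = max(M_n − 1, 0)`. -/
noncomputable def mle (n : ℕ) (y : Fin n → ℝ) : ℝ := max (Mstat n y - 1) 0

/-- The likelihood ratio statistic `T_n^L = 2{ℓ_n(ψ̂_n) − ℓ_n(ψ)}`. -/
noncomputable def lrStat (n : ℕ) (ψ : ℝ) (y : Fin n → ℝ) : ℝ :=
  2 * (loglik n (mle n y) y - loglik n ψ y)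

/-- `φ(u) = (log(1+u) - u/(1+u))/u²`, extended by `1/2` at zero. -/
noncomputable def phiAux : ℝ → ℝ :=
  Function.update (fun u => (Real.log (1 + u) - u / (1 + u)) / u ^ 2) 0 (1 / 2)

lemma phiAux_mul (u : ℝ) : u ^ 2 * phiAux u = Real.log (1 + u) - u / (1 + u) := by
  by_cases h : u = 0
  · subst h; simp
  · simp only [phiAux, Function.update_of_ne h]
    field_simp

lemma phiAux_continuousAt_zero : ContinuousAt phiAux 0 := by
  unfold phiAux
  rw [continuousAt_update_same]
  have hev : ∀ᶠ x : ℝ in 𝓝[≠] 0, -1 < x ∧ x ≠ 0 := by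
    apply Filter.Eventually.and
    · exact nhdsWithin_le_nhds (lt_mem_nhds (by norm_num))
    · exact self_mem_nhdsWithin
  have hc : ContinuousAt (fun u : ℝ => Real.log (1 + u) - u / (1 + u)) 0 := by
    apply ContinuousAt.sub
    · exact ContinuousAt.log (by fun_prop) (by norm_num)
    · exact ContinuousAt.div (by fun_prop) (by fun_prop) (by norm_num)
  refine HasDerivAt.lhopital_zero_nhdsNE (f' := fun u => u / (1 + u) ^ 2) (g' := fun u => 2 * u)
    ?_ ?_ ?_ ?_ ?_ ?_
  · filter_upwards [hev] with x hx
    have h1 : (1 + x) ≠ 0 := by linarith [hx.1]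
    have hd : HasDerivAt (fun u : ℝ => 1 + u) 1 x := (hasDerivAt_id x).const_add 1
    convert! (hd.log h1).sub ((hasDerivAt_id x).div hd h1) using 1
    simp only [id]
    field_simp
    ring
  · filter_upwards with x
    convert! hasDerivAt_pow 2 x using 1
    simp
  · filter_upwards [hev] with x hx
    simpa using hx.2
  · have := hc.tendsto
    simp only [add_zero, Real.log_one, zero_div, sub_zero] at this
    exact this.mono_left nhdsWithin_le_nhds
  · have : Tendsto (fun u : ℝ => u ^ 2) (𝓝 0) (𝓝 (0 ^ 2)) := (continuous_pow 2).tendsto 0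
    simp only [ne_eq, OfNat.ofNat_ne_zero, not_false_eq_true, zero_pow] at this
    exact this.mono_left nhdsWithin_le_nhds
  · have h2 : ContinuousAt (fun u : ℝ => 1 / (2 * (1 + u) ^ 2)) 0 :=
      ContinuousAt.div (by fun_prop) (by fun_prop) (by norm_num)
    have h3 := h2.tendsto
    simp only [add_zero, one_pow, mul_one] at h3
    refine (h3.mono_left nhdsWithin_le_nhds).congr' ?_
    filter_upwards [hev] with x hx
    have h1 : (1 + x) ≠ 0 := by linarith [hx.1]
    have := hx.2
    field_simp

lemma phiAux_continuousAt {u : ℝ} (hu : -1 < u) : ContinuousAt phiAux u := by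
  by_cases h : u = 0
  · subst h; exact phiAux_continuousAt_zero
  · unfold phiAux
    rw [continuousAt_update_of_ne h]
    have h1 : 1 + u ≠ 0 := by linarith
    refine ContinuousAt.div (ContinuousAt.sub (ContinuousAt.log (by fun_prop) h1)
      (ContinuousAt.div (by fun_prop) (by fun_prop) h1)) (by fun_prop) (by positivity)

lemma phiAux_comp_continuous : Continuous (fun u : ℝ => phiAux (max u (-(1 / 2)))) := by
  rw [continuous_iff_continuousAt]
  intro u
  have : -1 < max u (-(1 / 2)) := lt_of_lt_of_le (by norm_num) (le_max_right _ _)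
  exact ContinuousAt.comp (f := fun u : ℝ => max u (-(1 / 2))) (phiAux_continuousAt this) (by fun_prop)

/-- The jointly continuous function expressing the LR statistic. -/
noncomputable def gAux (p : ℝ × (ℝ × ℝ)) : ℝ :=
  √2 * p.1 * max (√2 * p.1) (-p.2.2) /
      (1 + max (p.2.1 * max (√2 * p.1) (-p.2.2)) (-(1 / 2)))
    - (max (√2 * p.1) (-p.2.2)) ^ 2 *
      phiAux (max (p.2.1 * max (√2 * p.1) (-p.2.2)) (-(1 / 2)))

lemma gAux_continuous : Continuous gAux := by
  unfold gAux
  refine Continuous.sub (Continuous.div (by fun_prop) (by fun_prop) ?_) (Continuous.mul (by fun_prop) ?_)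
  · intro p
    have := le_max_right (p.2.1 * max (√2 * p.1) (-p.2.2)) (-(1 / 2) : ℝ)
    linarith
  · exact phiAux_comp_continuous.comp (g := fun u : ℝ => phiAux (max u (-(1 / 2))))
      (f := fun p : ℝ × (ℝ × ℝ) => p.2.1 * max (√2 * p.1) (-p.2.2)) (by fun_prop)

lemma gAux_limit (w a : ℝ) : gAux (w, (0, a)) =
    2 * w * max w (-(a / √2)) - (max w (-(a / √2))) ^ 2 := by
  have h2 : (√2 : ℝ) * √2 = 2 := Real.mul_self_sqrt (by norm_num)
  have hs : max (√2 * w) (-a) = √2 * max w (-(a / √2)) := by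
    rw [mul_max_of_nonneg _ _ (Real.sqrt_nonneg 2)]
    congr 1
    field_simp
  have hm : max (0 : ℝ) (-(1 / 2)) = 0 := by norm_num
  simp only [gAux, hs, zero_mul, hm, phiAux, Function.update_self]
  linear_combination (w * max w (-(a / √2)) - (max w (-(a / √2))) ^ 2 / 2) * h2

lemma lrStat_eq (n : ℕ) (hn : 0 < n) (ψ : ℝ) (h0 : 0 ≤ ψ) (h1 : ψ ≤ 1) (ω : ℕ → ℝ) :
    lrStat n ψ (fun i => √(1 + ψ) * ω i) =
      gAux ((√(n : ℝ))⁻¹ * ∑ k ∈ Finset.range n, (ω k ^ 2 - 1) / √2,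
        ((√(n : ℝ))⁻¹, √(n : ℝ) * ψ / (1 + ψ))) := by
  have hn' : (0 : ℝ) < n := by exact_mod_cast hn
  have hsn : 0 < √(n : ℝ) := Real.sqrt_pos.2 hn'
  have hq : 0 < 1 + ψ := by linarith
  set w := (√(n : ℝ))⁻¹ * ∑ k ∈ Finset.range n, (ω k ^ 2 - 1) / √2 with hw
  set h := (√(n : ℝ))⁻¹ with hh
  have hpos : 0 < h := inv_pos.2 hsn
  have hnh : (n : ℝ) * h ^ 2 = 1 := by
    rw [hh, inv_pow, Real.sq_sqrt hn'.le, mul_inv_cancel₀ hn'.ne']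
  have hwS : (n : ℝ) * (√2 * w * h) = ∑ k ∈ Finset.range n, ω k ^ 2 - n := by
    have : (n : ℝ) * (√2 * w * h) = (n * h ^ 2) * (√2 * ∑ k ∈ Finset.range n, (ω k ^ 2 - 1) / √2) := by
      rw [hw]; ring
    rw [this, hnh, ← Finset.sum_div, Finset.sum_sub_distrib]
    simp
    field_simp
  have hM : Mstat n (fun i => √(1 + ψ) * ω i) = (1 + ψ) * (1 + √2 * w * h) := by
    simp only [Mstat, mul_pow, Real.sq_sqrt hq.le]
    rw [← Finset.mul_sum, Fin.sum_univ_eq_sum_range (fun i => ω i ^ 2) n]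
    field_simp
    linarith
  set s := max (√2 * w) (-(√(n : ℝ) * ψ / (1 + ψ))) with hs
  have hhs : h * s = max (√2 * w * h) (-(ψ / (1 + ψ))) := by
    rw [hs, mul_max_of_nonneg _ _ hpos.le]
    congr 1
    · ring
    · rw [hh]; field_simp
  have hlow : -(1 / 2) ≤ h * s := by
    rw [hhs]
    refine le_trans ?_ (le_max_right _ _)
    rw [neg_le_neg_iff, div_le_div_iff₀ hq (by norm_num)]
    linarith
  have hmle : 1 + mle n (fun i => √(1 + ψ) * ω i) = (1 + ψ) * (1 + h * s) := by
    rw [mle, hM, hhs, ← max_add_add_left, ← max_add_add_left, mul_max_of_nonneg _ _ hq.le]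
    congr 1
    · ring
    · field_simp; ring
  have hr : 0 < 1 + h * s := by linarith
  have hg : gAux (w, (h, √(n : ℝ) * ψ / (1 + ψ))) =
      √2 * w * s / (1 + h * s) - s ^ 2 * phiAux (h * s) := by
    simp only [gAux, ← hs, max_eq_left hlow]
  have hphi := phiAux_mul (h * s)
  have hs2 : s ^ 2 * phiAux (h * s) = n * (Real.log (1 + h * s) - h * s / (1 + h * s)) := by
    rw [← hphi]
    linear_combination (-s ^ 2 * phiAux (h * s)) * hnh
  rw [hg, hs2, lrStat, loglik, loglik, hmle, hM, Real.log_mul hq.ne' hr.ne']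
  field_simp
  linear_combination (√2 * w * s) * hnh

/-- The underlying iid standard normal sequence. -/
noncomputable def baseLaw : Measure (ℕ → ℝ) := Measure.infinitePi fun _ => gaussianReal 0 1

instance : IsProbabilityMeasure baseLaw := by unfold baseLaw; infer_instance

lemma modelLaw_eq (n : ℕ) (ψ : ℝ) (h0 : 0 ≤ ψ) :
    modelLaw n ψ = baseLaw.map (fun ω (i : Fin n) => √(1 + ψ) * ω i) := by
  have h1 := Measure.map_infinitePi_infinitePi_of_inj (P := fun _ : ℕ => gaussianReal 0 1)
    (Fin.val_injective (n := n))
  have h2 : (fun (ω : ℕ → ℝ) (i : Fin n) => √(1 + ψ) * ω i) =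
      (fun (x : Fin n → ℝ) i => √(1 + ψ) * x i) ∘ (fun ω i => ω i) := rfl
  have hp : ∀ _ : Fin n, IsProbabilityMeasure
      (Measure.map (fun x : ℝ => √(1 + ψ) * x) (gaussianReal 0 1)) :=
    fun _ => Measure.isProbabilityMeasure_map (by fun_prop)
  rw [h2, ← Measure.map_map (by fun_prop) (by fun_prop), baseLaw, h1,
    Measure.infinitePi_eq_pi, Measure.pi_map_pi (f := fun _ x => √(1 + ψ) * x) (by fun_prop), modelLaw]
  congr 1
  funext i
  rw [gaussianReal_map_const_mul]
  congr 1
  · simp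
  · ext
    simp [Real.sq_sqrt (show 0 ≤ 1 + ψ by linarith), show 0 ≤ 1 + ψ by linarith]

lemma moment_two : ∫ x : ℝ, x ^ 2 ∂(gaussianReal 0 1) = 1 := by
  have h := variance_fun_id_gaussianReal (μ := 0) (v := 1)
  rw [variance_eq_integral (by fun_prop)] at h
  simpa using h

lemma moment_four : ∫ x : ℝ, x ^ 4 ∂(gaussianReal 0 1) = 3 := by
  have h : iteratedDeriv 4 (mgf (fun x => x) (gaussianReal 0 1)) 0
      = ∫ x : ℝ, x ^ 4 ∂(gaussianReal 0 1) := by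
    rw [iteratedDeriv_mgf_zero] <;> simp
  rw [← h, mgf_fun_id_gaussianReal]
  have he : ∀ t : ℝ, HasDerivAt (fun t : ℝ => Real.exp (t ^ 2 / 2)) (t * Real.exp (t ^ 2 / 2)) t := by
    intro t
    convert! ((hasDerivAt_pow 2 t).div_const 2).exp using 1
    simp
    ring
  have e0 : (fun t : ℝ => Real.exp (0 * t + ((1 : NNReal) : ℝ) * t ^ 2 / 2))
      = fun t => Real.exp (t ^ 2 / 2) := by
    funext t; simp
  have e1 : deriv (fun t : ℝ => Real.exp (t ^ 2 / 2)) = fun t => t * Real.exp (t ^ 2 / 2) :=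
    funext fun t => (he t).deriv
  have e2 : deriv (fun t : ℝ => t * Real.exp (t ^ 2 / 2))
      = fun t => (1 + t ^ 2) * Real.exp (t ^ 2 / 2) := by
    funext t
    refine (((hasDerivAt_id t).mul (he t)).congr_deriv ?_).deriv
    simp only [id]; ring
  have e3 : deriv (fun t : ℝ => (1 + t ^ 2) * Real.exp (t ^ 2 / 2))
      = fun t => (3 * t + t ^ 3) * Real.exp (t ^ 2 / 2) := by
    funext t
    refine ((((hasDerivAt_pow 2 t).const_add 1).mul (he t)).congr_deriv ?_).deriv
    simp; ring
  have e4 : deriv (fun t : ℝ => (3 * t + t ^ 3) * Real.exp (t ^ 2 / 2)) 0 = 3 := by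
    refine (((((hasDerivAt_id (0 : ℝ)).const_mul 3).add (hasDerivAt_pow 3 0)).mul
      (he 0)).congr_deriv ?_).deriv
    simp
  rw [e0, iteratedDeriv_succ, iteratedDeriv_succ, iteratedDeriv_succ, iteratedDeriv_succ,
    iteratedDeriv_zero, e1, e2, e3, e4]

lemma integrable_pow_gauss (k : ℕ) : Integrable (fun x : ℝ => x ^ k) (gaussianReal 0 1) := by
  have := (memLp_id_gaussianReal (μ := 0) (v := 1) (k : NNReal)).integrable_norm_pow'
  refine this.mono (by fun_prop) ?_
  filter_upwards with x
  simp

lemma base_map_eval (i : ℕ) : baseLaw.map (fun ω => ω i) = gaussianReal 0 1 :=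
  Measure.infinitePi_map_eval (fun _ : ℕ => gaussianReal 0 1) i

lemma base_integral (f : ℝ → ℝ) (hf : Measurable f) (i : ℕ) :
    ∫ ω, f (ω i) ∂baseLaw = ∫ x, f x ∂(gaussianReal 0 1) := by
  rw [← base_map_eval i, integral_map (measurable_pi_apply i).aemeasurable hf.aestronglyMeasurable]

lemma clt_base : TendstoInDistribution
    (fun (n : ℕ) (ω : ℕ → ℝ) => (√(n : ℝ))⁻¹ * ∑ k ∈ Finset.range n, (ω k ^ 2 - 1) / √2)
    atTop (fun w : ℝ => w) (fun _ => baseLaw) (gaussianReal 0 1) := by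
  refine tendstoInDistribution_inv_sqrt_mul_sum (X := fun (k : ℕ) (ω : ℕ → ℝ) => (ω k ^ 2 - 1) / √2)
    ?_ ?_ ?_ ?_ ?_
  · exact ⟨by fun_prop, Measure.map_id⟩
  · rw [base_integral (fun x => (x ^ 2 - 1) / √2) (by fun_prop) 0, integral_div,
      integral_sub (integrable_pow_gauss 2) (by simp), moment_two]
    simp
  · simp only [Pi.pow_apply]
    rw [base_integral (fun x => ((x ^ 2 - 1) / √2) ^ 2) (by fun_prop) 0]
    have : ∀ x : ℝ, ((x ^ 2 - 1) / √2) ^ 2 = (x ^ 4 - 2 * x ^ 2 + 1) / 2 := by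
      intro x
      rw [div_pow, Real.sq_sqrt (by norm_num)]
      ring
    simp_rw [this]
    have hi : Integrable (fun x : ℝ => x ^ 4 - 2 * x ^ 2) (gaussianReal 0 1) :=
      (integrable_pow_gauss 4).sub ((integrable_pow_gauss 2).const_mul 2)
    rw [integral_div, integral_add hi (by simp),
      integral_sub (integrable_pow_gauss 4) ((integrable_pow_gauss 2).const_mul 2),
      integral_const_mul, moment_two, moment_four]
    simp
    norm_num
  · exact iIndepFun_infinitePi (P := fun _ : ℕ => gaussianReal 0 1)
      (X := fun _ x => (x ^ 2 - 1) / √2) (by fun_prop)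
  · intro i
    have : IdentDistrib (fun ω : ℕ → ℝ => ω i) (fun ω => ω 0) baseLaw baseLaw :=
      ⟨(measurable_pi_apply i).aemeasurable, (measurable_pi_apply 0).aemeasurable, by rw [base_map_eval, base_map_eval]⟩
    exact this.comp (u := fun x : ℝ => (x ^ 2 - 1) / √2) (by fun_prop)

lemma lrStat_measurable (n : ℕ) (ψ : ℝ) : Measurable (lrStat n ψ) := by
  unfold lrStat loglik mle Mstat
  fun_prop

/-- Under parameter sequences `ψ_n ≥ 0` with `√n ψ_n → a ∈ [0,∞)`, the law of the
likelihood ratio statistic converges weakly to the pushforward of `N(0,1)` by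
`w ↦ 2·w·max(w, −a·2^{-1/2}) − max(w, −a·2^{-1/2})²`. -/
theorem stmt4 (ψ : ℕ → ℝ) (hψ : ∀ n, 0 ≤ ψ n) (a : ℝ) (ha0 : 0 ≤ a)
    (ha : Tendsto (fun n : ℕ => Real.sqrt (n : ℝ) * ψ n) atTop (𝓝 a)) :
    ∀ f : BoundedContinuousFunction ℝ ℝ,
      Tendsto (fun n => ∫ t, f t ∂(Measure.map (lrStat n (ψ n)) (modelLaw n (ψ n))))
        atTop
        (𝓝 (∫ t, f t ∂(Measure.map
            (fun w => 2 * w * max w (-(a / Real.sqrt 2)) - (max w (-(a / Real.sqrt 2))) ^ 2)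
            (gaussianReal 0 1)))) := by
  intro f
  have hinv : Tendsto (fun n : ℕ => (√(n : ℝ))⁻¹) atTop (𝓝 0) :=
    tendsto_inv_atTop_zero.comp (Real.tendsto_sqrt_atTop.comp tendsto_natCast_atTop_atTop)
  have hψ0 : Tendsto ψ atTop (𝓝 0) := by
    have h := hinv.mul ha
    rw [zero_mul] at h
    refine h.congr' ?_
    filter_upwards [eventually_gt_atTop 0] with n hn
    have : 0 < √(n : ℝ) := Real.sqrt_pos.2 (by exact_mod_cast hn)
    field_simp
  have hc : Tendsto (fun n : ℕ => √(n : ℝ) * ψ n / (1 + ψ n)) atTop (𝓝 a) := by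
    have h := ha.div (hψ0.const_add 1) (by norm_num)
    rw [add_zero, div_one] at h
    exact h
  have hY : TendstoInMeasure baseLaw
      (fun (n : ℕ) (_ : ℕ → ℝ) => ((√(n : ℝ))⁻¹, √(n : ℝ) * ψ n / (1 + ψ n))) atTop
      (fun _ => ((0 : ℝ), a)) :=
    tendstoInMeasure_of_tendsto_ae (fun n => aestronglyMeasurable_const)
      (ae_of_all _ fun _ => hinv.prodMk_nhds hc)
  have key := clt_base.continuous_comp_prodMk_of_tendstoInMeasure_const gAux_continuous hY
    (fun n => aemeasurable_const)
  have h1 := (ProbabilityMeasure.tendsto_iff_forall_integral_tendsto.1 key.tendsto) f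
  simp only [ProbabilityMeasure.coe_mk, gAux_limit] at h1
  refine h1.congr' ?_
  filter_upwards [eventually_gt_atTop 0, hψ0.eventually_le_const (by norm_num : (0 : ℝ) < 1)]
    with n hn hn1
  rw [modelLaw_eq n (ψ n) (hψ n), Measure.map_map (lrStat_measurable _ _) (by fun_prop)]
  congr 2
  funext ω
  exact (lrStat_eq n hn (ψ n) (hψ n) hn1 ω).symm
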